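/- arXiv:2007.12448 — 2 statements merged into one kernel-verified Lean document; each statement's English description precedes it below -/
import Mathlib

section
/- For every x ∈ ℝ, the map μ ↦ Φ⁻¹(F_μ(x)) is differentiable on ℝ and its derivative satisfies ∂Φ⁻¹(F_μ(x))/∂μ < −ρ/σ for all μ ∈ ℝ. -/
open MeasureTheory ProbabilityTheory Set Filter Topology

noncomputable def stdphi (x : ℝ) : ℝ := Real.exp (-(x ^ 2) / 2) / Real.sqrt (2 * Real.pi)

noncomputable def stdPhi (x : ℝ) : ℝ := ∫ t in Iic x, stdphi t

noncomputable def stdPhiInv : ℝ → ℝ := Function.invFun stdPhi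

noncomputable def stdPhiE (c : EReal) (x s : ℝ) : ℝ :=
  if c = ⊤ then 1 else if c = ⊥ then 0 else stdPhi ((c.toReal - x) / s)

def truncOrdered {k : ℕ} (a b : Fin k → EReal) : Prop :=
  (∀ i, a i < b i) ∧ ∀ i j : Fin k, i < j → b i < a j

def truncSet {k : ℕ} (a b : Fin k → EReal) : Set ℝ :=
  {x : ℝ | ∃ i, a i < (x : EReal) ∧ (x : EReal) < b i}

noncomputable def truncSum {k : ℕ} (a b : Fin k → EReal) (s x : ℝ) : ℝ :=
  ∑ i, (stdPhiE (b i) x s - stdPhiE (a i) x s)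

noncomputable def condPDF {k : ℕ} (a b : Fin k → EReal) (σ τ μ x : ℝ) : ℝ :=
  (1 / σ) * stdphi ((x - μ) / σ) * truncSum a b τ x
    / truncSum a b (Real.sqrt (σ ^ 2 + τ ^ 2)) μ

noncomputable def Fmu {k : ℕ} (a b : Fin k → EReal) (σ τ μ x : ℝ) : ℝ :=
  ∫ u in Iic x, condPDF a b σ τ μ u

/-- `G_μ(x,v) = Φ((x - (ρ²μ + (1-ρ²)v))/(σρ))` with `ρ² = τ²/(σ²+τ²)`. -/
noncomputable def Gfun (σ τ μ x v : ℝ) : ℝ :=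
  stdPhi ((x - (τ ^ 2 / (σ ^ 2 + τ ^ 2) * μ + (1 - τ ^ 2 / (σ ^ 2 + τ ^ 2)) * v)) /
    (σ * Real.sqrt (τ ^ 2 / (σ ^ 2 + τ ^ 2))))

/-- `G_μ(x,v)` for an extended-real `v`, with the natural conventions at `±∞`. -/
noncomputable def GfunE (σ τ μ x : ℝ) (c : EReal) : ℝ :=
  if c = ⊤ then 0 else if c = ⊥ then 1 else Gfun σ τ μ x c.toReal

/-- `h(v)` from Lemma `le_dmu_formula`. -/
noncomputable def hfun {k : ℕ} (a b : Fin k → EReal) (σ τ μ v : ℝ) : ℝ :=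
  (1 / Real.sqrt (σ ^ 2 + τ ^ 2)) * stdphi ((v - μ) / Real.sqrt (σ ^ 2 + τ ^ 2)) /
    truncSum a b (Real.sqrt (σ ^ 2 + τ ^ 2)) μ

/-- `h(v)` for an extended-real `v`, with the convention `φ(±∞) = 0`. -/
noncomputable def hfunE {k : ℕ} (a b : Fin k → EReal) (σ τ μ : ℝ) (c : EReal) : ℝ :=
  if c = ⊤ then 0 else if c = ⊥ then 0 else hfun a b σ τ μ c.toReal

/-- `l(x,v)` from Lemma `le_dens_dx`. -/
noncomputable def lfun {k : ℕ} (a b : Fin k → EReal) (τ x v : ℝ) : ℝ :=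
  (1 / τ) * stdphi ((v - x) / τ) / truncSum a b τ x

/-- `l(x,v)` for an extended-real `v`, with the convention `φ(±∞) = 0`. -/
noncomputable def lfunE {k : ℕ} (a b : Fin k → EReal) (τ x : ℝ) (c : EReal) : ℝ :=
  if c = ⊤ then 0 else if c = ⊥ then 0 else lfun a b τ x c.toReal

/-- The function `B_μ(x)` from the proof of Proposition 1. -/
noncomputable def Bfun {k : ℕ} (a b : Fin k → EReal) (σ τ μ x : ℝ) : ℝ :=
  Real.sqrt (τ ^ 2 / (σ ^ 2 + τ ^ 2)) / σ * stdphi (stdPhiInv (Fmu a b σ τ μ x))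
    - condPDF a b σ τ μ x
    + ∑ i, (hfunE a b σ τ μ (b i) * (Fmu a b σ τ μ x - GfunE σ τ μ x (b i))
        - hfunE a b σ τ μ (a i) * (Fmu a b σ τ μ x - GfunE σ τ μ x (a i)))

/-- The density of the normal distribution with mean `m` and standard deviation `s`. -/
noncomputable def normalDensity (m s v : ℝ) : ℝ := 1 / s * stdphi ((v - m) / s)

lemma stdphi_pos (x : ℝ) : 0 < stdphi x := by
  unfold stdphi; positivity

lemma continuous_stdphi : Continuous stdphi := by
  unfold stdphi; fun_prop

lemma stdphi_le_exp (x : ℝ) : stdphi x ≤ Real.exp (-(x ^ 2) / 2) := by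
  unfold stdphi
  apply div_le_self (Real.exp_pos _).le
  rw [Real.one_le_sqrt]
  nlinarith [Real.pi_gt_three]

lemma stdphi_le_one (x : ℝ) : stdphi x ≤ 1 :=
  (stdphi_le_exp x).trans (Real.exp_le_one_iff.mpr (by nlinarith [sq_nonneg x]))

lemma hasDerivAt_stdphi (x : ℝ) : HasDerivAt stdphi (-x * stdphi x) x := by
  unfold stdphi
  have h : HasDerivAt (fun y : ℝ => -(y ^ 2) / 2) (-x) x :=
    (((hasDerivAt_pow 2 x).neg).div_const 2).congr_deriv (by norm_num; ring)
  exact (h.exp.div_const (Real.sqrt (2 * Real.pi))).congr_deriv (by ring)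

lemma stdphi_eq_gaussianPDFReal : stdphi = gaussianPDFReal 0 1 := by
  ext x
  simp [stdphi, gaussianPDFReal_def]
  field_simp

lemma integrable_stdphi : Integrable stdphi := by
  rw [stdphi_eq_gaussianPDFReal]
  exact integrable_gaussianPDFReal 0 1

lemma integral_stdphi : ∫ x, stdphi x = 1 := by
  rw [stdphi_eq_gaussianPDFReal]
  exact integral_gaussianPDFReal_eq_one 0 one_ne_zero

lemma stdPhi_nonneg (x : ℝ) : 0 ≤ stdPhi x :=
  integral_nonneg fun t => (stdphi_pos t).le

lemma stdPhi_le_one (x : ℝ) : stdPhi x ≤ 1 := by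
  rw [← integral_stdphi]
  exact setIntegral_le_integral integrable_stdphi (ae_of_all _ fun t => (stdphi_pos t).le)

lemma hasDerivAt_stdPhi (x : ℝ) : HasDerivAt stdPhi (stdphi x) x := by
  have h : stdPhi = fun y => stdPhi 0 + ∫ t in (0 : ℝ)..y, stdphi t := by
    ext y
    rw [← intervalIntegral.integral_Iic_sub_Iic integrable_stdphi.integrableOn
      integrable_stdphi.integrableOn]
    simp [stdPhi]
  rw [h]
  exact (continuous_stdphi.integral_hasStrictDerivAt 0 x).hasDerivAt.const_add _

lemma continuous_stdPhi : Continuous stdPhi :=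
  continuous_iff_continuousAt.mpr fun x => (hasDerivAt_stdPhi x).continuousAt

lemma strictMono_stdPhi : StrictMono stdPhi :=
  strictMono_of_hasDerivAt_pos hasDerivAt_stdPhi stdphi_pos

lemma stdPhi_eq_cdf : stdPhi = cdf (gaussianReal 0 1) := by
  ext x
  rw [cdf_eq_real, measureReal_def, gaussianReal_apply_eq_integral 0 one_ne_zero,
    ← stdphi_eq_gaussianPDFReal]
  exact (ENNReal.toReal_ofReal (stdPhi_nonneg x)).symm

lemma stdPhi_pos (x : ℝ) : 0 < stdPhi x :=
  (stdPhi_nonneg (x - 1)).trans_lt (strictMono_stdPhi (by linarith))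

lemma stdPhi_lt_one (x : ℝ) : stdPhi x < 1 :=
  (strictMono_stdPhi (by linarith)).trans_le (stdPhi_le_one (x + 1))

lemma exists_stdPhi_eq {p : ℝ} (h0 : 0 < p) (h1 : p < 1) : ∃ z, stdPhi z = p := by
  refine mem_range_of_exists_le_of_exists_ge continuous_stdPhi ?_ ?_
  · rw [stdPhi_eq_cdf]
    exact ((tendsto_cdf_atBot _).eventually (eventually_le_nhds h0)).exists
  · rw [stdPhi_eq_cdf]
    exact ((tendsto_cdf_atTop _).eventually (eventually_ge_nhds h1)).exists

lemma hasDerivAt_stdPhiInv (z : ℝ) : HasDerivAt stdPhiInv (stdphi z)⁻¹ (stdPhi z) := by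
  have h : HasStrictDerivAt stdPhi (stdphi z) z :=
    hasStrictDerivAt_of_hasDerivAt_of_continuousAt (Eventually.of_forall hasDerivAt_stdPhi)
      continuous_stdphi.continuousAt
  exact (h.to_local_left_inverse (stdphi_pos z).ne'
    (Eventually.of_forall (Function.leftInverse_invFun strictMono_stdPhi.injective))).hasDerivAt

/-- The antiderivative `y Φ(y) + φ(y)` of `Φ` lies strictly above each of its tangents. -/
lemma stdPhi_tangent_lt {y z : ℝ} (h : y ≠ z) :
    y * stdPhi z + stdphi z < y * stdPhi y + stdphi y := by
  have hd : ∀ t, HasDerivAt (fun t => t * stdPhi t + stdphi t) (stdPhi t) t := fun t =>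
    (((hasDerivAt_id t).mul (hasDerivAt_stdPhi t)).add (hasDerivAt_stdphi t)).congr_deriv
      (by simp)
  have hc : Continuous fun t => t * stdPhi t + stdphi t :=
    continuous_iff_continuousAt.mpr fun t => (hd t).continuousAt
  rcases h.lt_or_gt with h | h
  · obtain ⟨c, hc, hc'⟩ := exists_hasDerivAt_eq_slope _ stdPhi h hc.continuousOn fun t _ => hd t
    rw [eq_div_iff (by linarith)] at hc'
    nlinarith [strictMono_stdPhi hc.2]
  · obtain ⟨c, hc, hc'⟩ := exists_hasDerivAt_eq_slope _ stdPhi h hc.continuousOn fun t _ => hd t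
    rw [eq_div_iff (by linarith)] at hc'
    nlinarith [strictMono_stdPhi hc.1]

lemma normalDensity_pos {s : ℝ} (hs : 0 < s) (m v : ℝ) : 0 < normalDensity m s v :=
  mul_pos (by positivity) (stdphi_pos _)

lemma continuous_normalDensity (m s : ℝ) : Continuous (normalDensity m s) := by
  unfold normalDensity
  exact continuous_const.mul (continuous_stdphi.comp (by fun_prop))

lemma integrable_normalDensity {s : ℝ} (hs : 0 < s) (m : ℝ) : Integrable (normalDensity m s) :=
  ((integrable_stdphi.comp_div hs.ne').comp_sub_right m).const_mul (1 / s)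

lemma setIntegral_normalDensity {s : ℝ} (hs : 0 < s) (m : ℝ) {A : Set ℝ} (hA : MeasurableSet A) :
    ∫ v in (fun v => (v - m) / s) ⁻¹' A, normalDensity m s v = ∫ t in A, stdphi t := by
  have hA' : MeasurableSet ((fun v => (v - m) / s) ⁻¹' A) := (by fun_prop : Measurable
    fun v : ℝ => (v - m) / s) hA
  rw [← integral_indicator hA', ← integral_indicator hA]
  have h : ((fun v => (v - m) / s) ⁻¹' A).indicator (normalDensity m s)
      = fun v => (fun w => 1 / s * A.indicator stdphi (w / s)) (v - m) := by
    ext v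
    by_cases hv : (v - m) / s ∈ A <;> simp [hv, normalDensity]
  rw [h, integral_sub_right_eq_self, integral_const_mul,
    Measure.integral_comp_div (fun w => A.indicator stdphi w), abs_of_pos hs, smul_eq_mul]
  field_simp

lemma integral_normalDensity {s : ℝ} (hs : 0 < s) (m : ℝ) : ∫ v, normalDensity m s v = 1 := by
  simpa [integral_stdphi] using setIntegral_normalDensity hs m MeasurableSet.univ

lemma setIntegral_Iic_normalDensity {s : ℝ} (hs : 0 < s) (m x : ℝ) :
    ∫ v in Iic x, normalDensity m s v = stdPhi ((x - m) / s) := by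
  rw [stdPhi, ← setIntegral_normalDensity hs m measurableSet_Iic]
  congr 2
  ext v
  simp [div_le_div_iff_of_pos_right hs]

lemma stdPhiE_eq_setIntegral {s : ℝ} (hs : 0 < s) (c : EReal) (m : ℝ) :
    stdPhiE c m s = ∫ v in {v : ℝ | (v : EReal) ≤ c}, normalDensity m s v := by
  unfold stdPhiE
  induction c with
  | bot => simp
  | top => simp [integral_normalDensity hs]
  | coe r => simpa [Iic] using (setIntegral_Iic_normalDensity hs m r).symm

lemma measurableSet_coe_preimage_Ioc (a b : EReal) :
    MeasurableSet {v : ℝ | a < v ∧ (v : EReal) ≤ b} :=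
  measurable_coe_real_ereal measurableSet_Ioc

lemma stdPhiE_sub_stdPhiE {s : ℝ} (hs : 0 < s) {a b : EReal} (hab : a < b) (m : ℝ) :
    stdPhiE b m s - stdPhiE a m s
      = ∫ v in {v : ℝ | a < v ∧ (v : EReal) ≤ b}, normalDensity m s v := by
  have hm : ∀ c : EReal, MeasurableSet {v : ℝ | (v : EReal) ≤ c} := fun c =>
    measurable_coe_real_ereal measurableSet_Iic
  rw [stdPhiE_eq_setIntegral hs, stdPhiE_eq_setIntegral hs,
    ← setIntegral_sdiff (hm a) (integrable_normalDensity hs m).integrableOn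
      (show {v : ℝ | (v : EReal) ≤ a} ⊆ {v : ℝ | (v : EReal) ≤ b} from
        fun v hv => le_trans hv hab.le)]
  congr 2
  ext v
  simp [and_comm]

/-- The truncation set, up to the finitely many endpoints. -/
def truncSupport {k : ℕ} (a b : Fin k → EReal) : Set ℝ :=
  ⋃ i, {v : ℝ | a i < v ∧ (v : EReal) ≤ b i}

lemma truncSum_eq_setIntegral {k : ℕ} {a b : Fin k → EReal} (hab : truncOrdered a b)
    {s : ℝ} (hs : 0 < s) (m : ℝ) :
    truncSum a b s m = ∫ v in truncSupport a b, normalDensity m s v := by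
  rw [truncSupport, integral_iUnion_fintype (fun i => measurableSet_coe_preimage_Ioc _ _) ?_
    fun i => (integrable_normalDensity hs m).integrableOn]
  · exact Finset.sum_congr rfl fun i _ => stdPhiE_sub_stdPhiE hs (hab.1 i) m
  · refine (pairwise_disjoint_on _).mpr fun i j hij => ?_
    rw [Set.disjoint_left]
    rintro v ⟨_, hv⟩ ⟨hv', _⟩
    exact absurd (hv.trans_lt (hab.2 i j hij)) hv'.le.not_gt

lemma volume_truncSupport_pos {k : ℕ} {a b : Fin (k + 1) → EReal} (hab : truncOrdered a b) :
    0 < volume (truncSupport a b) := by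
  obtain ⟨p, hp, hpb⟩ := EReal.lt_iff_exists_real_btwn.mp (hab.1 0)
  obtain ⟨q, hpq, hq⟩ := EReal.lt_iff_exists_real_btwn.mp hpb
  have h : Ioo p q ⊆ truncSupport a b := fun v hv => mem_iUnion.mpr
    ⟨0, hp.trans (EReal.coe_lt_coe_iff.mpr hv.1), ((EReal.coe_lt_coe_iff.mpr hv.2).trans hq).le⟩
  refine lt_of_lt_of_le ?_ (measure_mono h)
  simpa using hpq

/-- The joint density of `(X, X + U)` as the density of `X + U` times that of `X` given `X + U`. -/
lemma normalDensity_mul_normalDensity {σ τ s : ℝ} (hσ : 0 < σ) (hτ : 0 < τ) (hs : 0 < s)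
    (hs2 : s ^ 2 = σ ^ 2 + τ ^ 2) (μ u v : ℝ) :
    normalDensity μ σ u * normalDensity u τ v = normalDensity μ s v *
      normalDensity ((τ ^ 2 * μ + σ ^ 2 * v) / s ^ 2) (σ * τ / s) u := by
  have he : -(((u - μ) / σ) ^ 2) / 2 + -(((v - u) / τ) ^ 2) / 2 = -(((v - μ) / s) ^ 2) / 2
      + -(((u - (τ ^ 2 * μ + σ ^ 2 * v) / s ^ 2) / (σ * τ / s)) ^ 2) / 2 := by
    have : τ ^ 2 = s ^ 2 - σ ^ 2 := by linarith
    field_simp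
    rw [this]
    ring
  have hp : ∀ A B : ℝ, stdphi A * stdphi B
      = Real.exp (-(A ^ 2) / 2 + -(B ^ 2) / 2) / (Real.sqrt (2 * Real.pi)) ^ 2 := fun A B => by
    rw [stdphi, stdphi, Real.exp_add]; ring
  unfold normalDensity
  rw [mul_mul_mul_comm, hp, he, ← hp, mul_mul_mul_comm (1 / s)]
  congr 1
  field_simp

lemma integrable_normalDensity_mul_prod {σ τ : ℝ} (hσ : 0 < σ) (hτ : 0 < τ) (μ : ℝ) :
    Integrable (fun p : ℝ × ℝ => normalDensity μ σ p.1 * normalDensity p.1 τ p.2)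
      (volume.prod volume) := by
  have hc : Continuous fun p : ℝ × ℝ => normalDensity μ σ p.1 * normalDensity p.1 τ p.2 := by
    refine ((continuous_normalDensity μ σ).comp continuous_fst).mul ?_
    unfold normalDensity
    exact continuous_const.mul (continuous_stdphi.comp (by fun_prop))
  rw [integrable_prod_iff hc.aestronglyMeasurable]
  refine ⟨ae_of_all _ fun u => (integrable_normalDensity hτ u).const_mul (normalDensity μ σ u), ?_⟩
  refine (integrable_normalDensity hσ μ).congr (ae_of_all _ fun u => ?_)
  simp_rw [norm_mul, Real.norm_of_nonneg (normalDensity_pos hσ μ u).le,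
    Real.norm_of_nonneg (normalDensity_pos hτ u _).le]
  rw [integral_const_mul, integral_normalDensity hτ, mul_one]

/-- `F_μ(x)` as an average of the conditional distribution functions of `X` given `X + U`. -/
lemma Fmu_eq_div {k : ℕ} {a b : Fin k → EReal} (hab : truncOrdered a b) {σ τ s : ℝ}
    (hσ : 0 < σ) (hτ : 0 < τ) (hs : 0 < s) (hs2 : s ^ 2 = σ ^ 2 + τ ^ 2) (μ x : ℝ) :
    Fmu a b σ τ μ x = (∫ v in truncSupport a b, normalDensity μ s v *
      stdPhi ((x - (τ ^ 2 * μ + σ ^ 2 * v) / s ^ 2) / (σ * τ / s)))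
        / ∫ v in truncSupport a b, normalDensity μ s v := by
  have hsq : Real.sqrt (σ ^ 2 + τ ^ 2) = s := by rw [← hs2, Real.sqrt_sq hs.le]
  unfold Fmu condPDF
  rw [integral_div, hsq, truncSum_eq_setIntegral hab hs]
  congr 1
  have h1 : ∀ u, 1 / σ * stdphi ((u - μ) / σ) * truncSum a b τ u
      = ∫ v in truncSupport a b, normalDensity μ σ u * normalDensity u τ v := fun u => by
    rw [integral_const_mul, truncSum_eq_setIntegral hab hτ]; rfl
  simp_rw [h1]
  rw [integral_integral_swap]
  · refine integral_congr_ae (ae_of_all _ fun v => ?_)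
    simp only [normalDensity_mul_normalDensity hσ hτ hs hs2]
    rw [integral_const_mul, setIntegral_Iic_normalDensity (by positivity)]
  · rw [Measure.prod_restrict]
    exact (integrable_normalDensity_mul_prod hσ hτ μ).integrableOn

lemma normalDensity_le_of_abs_sub_le {s : ℝ} (hs : 0 < s) {m μ : ℝ} (h : |m - μ| ≤ 1) (v : ℝ) :
    normalDensity m s v ≤ 1 / s * Real.exp (1 / (2 * s ^ 2))
      * Real.exp (-(1 / (4 * s ^ 2)) * (v - μ) ^ 2) := by
  unfold normalDensity
  rw [mul_assoc, ← Real.exp_add]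
  refine mul_le_mul_of_nonneg_left ((stdphi_le_exp _).trans (Real.exp_le_exp.mpr ?_))
    (by positivity)
  have h1 : (m - μ) ^ 2 ≤ 1 := by rw [← sq_abs]; nlinarith [abs_nonneg (m - μ)]
  have h2 : -((v - m) / s) ^ 2 / 2 = -(2 * (v - m) ^ 2) / (4 * s ^ 2) := by field_simp; ring
  have h3 : 1 / (2 * s ^ 2) + -(1 / (4 * s ^ 2)) * (v - μ) ^ 2
      = (2 - (v - μ) ^ 2) / (4 * s ^ 2) := by field_simp; ring
  rw [h2, h3]
  gcongr
  nlinarith [sq_nonneg ((v - m) - (m - μ))]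

lemma integrable_abs_sub_add_mul_exp {s : ℝ} (hs : 0 < s) (μ C : ℝ) :
    Integrable fun v : ℝ => (|v - μ| + C) * Real.exp (-(1 / (4 * s ^ 2)) * (v - μ) ^ 2) := by
  have hb : 0 < 1 / (4 * s ^ 2) := by positivity
  have h := ((integrable_mul_exp_neg_mul_sq hb).norm.add
    ((integrable_exp_neg_mul_sq hb).const_mul C)).comp_sub_right μ
  convert h using 2 with v
  simp [add_mul]

lemma hasDerivAt_normalDensity (s m v : ℝ) :
    HasDerivAt (fun m => normalDensity m s v) (normalDensity m s v * ((v - m) / s ^ 2)) m := by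
  have h : HasDerivAt (fun m => (v - m) / s) (-1 / s) m :=
    ((hasDerivAt_id m).const_sub v).div_const s
  exact (((hasDerivAt_stdphi _).comp m h).const_mul (1 / s)).congr_deriv
    (by unfold normalDensity; ring)

lemma integrable_normalDensity_mul {s : ℝ} (hs : 0 < s) (μ : ℝ) {f : ℝ → ℝ}
    (hf : Continuous f) {A B : ℝ} (hB : ∀ v, |f v| ≤ A * (|v - μ| + B)) :
    Integrable fun v => normalDensity μ s v * f v := by
  refine ((integrable_abs_sub_add_mul_exp hs μ B).const_mul
    (1 / s * Real.exp (1 / (2 * s ^ 2)) * A)).mono'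
    ((continuous_normalDensity μ s).mul hf).aestronglyMeasurable (ae_of_all _ fun v => ?_)
  rw [norm_mul, Real.norm_of_nonneg (normalDensity_pos hs μ v).le, Real.norm_eq_abs]
  refine (mul_le_mul (normalDensity_le_of_abs_sub_le hs (m := μ) (μ := μ) (by simp) v) (hB v) (abs_nonneg _)
    (by positivity)).trans_eq (by ring)

/-- Differentiation in `μ` under an integral against the `N(μ, s²)` density. -/
lemma hasDerivAt_setIntegral_normalDensity_mul {s : ℝ} (hs : 0 < s) (T : Set ℝ)
    {g g' : ℝ → ℝ → ℝ} {K : ℝ} (hg : ∀ m v, HasDerivAt (fun m => g m v) (g' m v) m)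
    (hgc : ∀ m, Continuous (g m)) (hgc' : ∀ m, Continuous (g' m))
    (hg1 : ∀ m v, |g m v| ≤ 1) (hgK : ∀ m v, |g' m v| ≤ K) (μ : ℝ) :
    HasDerivAt (fun m => ∫ v in T, normalDensity m s v * g m v)
      (∫ v in T, normalDensity μ s v * ((v - μ) / s ^ 2 * g μ v + g' μ v)) μ := by
  have hK : 0 ≤ K := (abs_nonneg _).trans (hgK 0 0)
  set C := 1 / s * Real.exp (1 / (2 * s ^ 2))
  refine (hasDerivAt_integral_of_dominated_loc_of_deriv_le (𝕜 := ℝ)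
    (Metric.closedBall_mem_nhds μ one_pos)
    (bound := fun v => C * (1 / s ^ 2) * ((|v - μ| + (1 + s ^ 2 * K))
      * Real.exp (-(1 / (4 * s ^ 2)) * (v - μ) ^ 2)))
    (F' := fun m v => normalDensity m s v * ((v - m) / s ^ 2 * g m v + g' m v))
    (Eventually.of_forall fun m =>
      ((continuous_normalDensity m s).mul (hgc m)).aestronglyMeasurable) ?_
    ((continuous_normalDensity μ s).mul (((by fun_prop : Continuous fun v : ℝ =>
      (v - μ) / s ^ 2).mul (hgc μ)).add (hgc' μ))).aestronglyMeasurable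
    (ae_of_all _ fun v m hm => ?_) ?_ (ae_of_all _ fun v m _ => ?_)).2
  · refine (integrable_normalDensity_mul hs μ (hgc μ) (A := 1) (B := 1) fun v => ?_).restrict
    linarith [hg1 μ v, abs_nonneg (v - μ)]
  · rw [Metric.mem_closedBall, Real.dist_eq] at hm
    rw [norm_mul, Real.norm_of_nonneg (normalDensity_pos hs m v).le, Real.norm_eq_abs]
    have h1 : |(v - m) / s ^ 2 * g m v + g' m v| ≤ 1 / s ^ 2 * (|v - μ| + (1 + s ^ 2 * K)) := by
      have h2 : |v - m| ≤ |v - μ| + 1 := by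
        have := abs_sub_le v μ m
        rw [abs_sub_comm μ m] at this
        linarith
      have h3 : |(v - m) / s ^ 2 * g m v| ≤ (|v - μ| + 1) / s ^ 2 * 1 := by
        rw [abs_mul, abs_div, abs_of_pos (by positivity : 0 < s ^ 2)]
        exact mul_le_mul (by gcongr) (hg1 m v) (abs_nonneg _) (by positivity)
      have h4 : 1 / s ^ 2 * (|v - μ| + (1 + s ^ 2 * K)) = (|v - μ| + 1) / s ^ 2 * 1 + K := by
        field_simp; ring
      rw [h4]
      exact (abs_add_le _ _).trans (add_le_add h3 (hgK m v))
    refine (mul_le_mul (normalDensity_le_of_abs_sub_le hs hm v) h1 (abs_nonneg _)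
      (by positivity)).trans_eq (by ring)
  · exact ((integrable_abs_sub_add_mul_exp hs μ _).const_mul _).restrict
  · exact ((hasDerivAt_normalDensity s m v).mul (hg m v)).congr_deriv (by ring)

lemma integral_pos_of_ae_pos {α : Type*} [MeasurableSpace α] {ν : Measure α} (hν : ν ≠ 0)
    {f : α → ℝ} (hf : Integrable f ν) (h : ∀ᵐ v ∂ν, 0 < f v) : 0 < ∫ v, f v ∂ν := by
  rw [integral_pos_iff_support_of_nonneg_ae (h.mono fun v hv => hv.le) hf]
  have hs : Function.support f =ᵐ[ν] univ :=
    eventuallyEq_univ.mpr (h.mono fun v hv => hv.ne')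
  rw [measure_congr hs]
  exact Measure.measure_univ_pos.mpr hν

lemma hasDerivAt_Fmu_lt {k : ℕ} {a b : Fin (k + 1) → EReal} (hab : truncOrdered a b)
    {σ τ s : ℝ} (hσ : 0 < σ) (hτ : 0 < τ) (hs : 0 < s) (hs2 : s ^ 2 = σ ^ 2 + τ ^ 2) (x μ : ℝ) :
    ∃ z e : ℝ, stdPhi z = Fmu a b σ τ μ x ∧ HasDerivAt (fun m => Fmu a b σ τ m x) e μ ∧
      e < -(τ / s / σ) * stdphi z := by
  set T := truncSupport a b
  have hT : volume.restrict T ≠ 0 := by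
    rw [Ne, Measure.restrict_eq_zero]
    exact (volume_truncSupport_pos hab).ne'
  set c := σ * τ / s with hc
  have hc0 : 0 < c := by positivity
  set y : ℝ → ℝ → ℝ := fun m v => (x - (τ ^ 2 * m + σ ^ 2 * v) / s ^ 2) / c with hy
  have hyc : ∀ m, Continuous (y m) := fun m => by fun_prop
  have hyd : ∀ m v, HasDerivAt (fun m => y m v) (-(τ ^ 2 / s ^ 2) / c) m := fun m v =>
    ((((((hasDerivAt_id m).const_mul (τ ^ 2)).add_const (σ ^ 2 * v)).div_const
      (s ^ 2)).const_sub x).div_const c).congr_deriv (by ring)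
  set g' : ℝ → ℝ → ℝ := fun m v => stdphi (y m v) * (-(τ ^ 2 / s ^ 2) / c) with hg'
  have hg'c : ∀ m, Continuous (g' m) := fun m =>
    (continuous_stdphi.comp (hyc m)).mul continuous_const
  have hg'b : ∀ m v, |g' m v| ≤ τ ^ 2 / s ^ 2 / c := fun m v => by
    rw [hg', abs_mul, abs_of_pos (stdphi_pos _), neg_div, abs_neg, abs_of_pos (by positivity)]
    exact mul_le_of_le_one_left (by positivity) (stdphi_le_one _)
  have hΦb : ∀ m v, |stdPhi (y m v)| ≤ 1 := fun m v => by
    rw [abs_of_pos (stdPhi_pos _)]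
    exact stdPhi_le_one _
  have hΦc : ∀ m, Continuous fun v => stdPhi (y m v) := fun m => continuous_stdPhi.comp (hyc m)
  have hA := hasDerivAt_setIntegral_normalDensity_mul hs T (g := fun m v => stdPhi (y m v))
    (g' := g') (fun m v => (hasDerivAt_stdPhi _).comp m (hyd m v)) hΦc hg'c hΦb hg'b μ
  have hN := hasDerivAt_setIntegral_normalDensity_mul hs T (g := fun _ _ => 1)
    (g' := fun _ _ => 0) (K := 0) (fun m v => hasDerivAt_const m 1) (fun _ => continuous_const)
    (fun _ => continuous_const) (by simp) (by simp) μ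
  simp only [mul_one, add_zero] at hN
  have iN : IntegrableOn (normalDensity μ s) T := (integrable_normalDensity hs μ).integrableOn
  have iA : IntegrableOn (fun v => normalDensity μ s v * stdPhi (y μ v)) T :=
    (integrable_normalDensity_mul hs μ (hΦc μ) (A := 1) (B := 1) fun v => by
      linarith [hΦb μ v, abs_nonneg (v - μ)]).integrableOn
  have iM : Integrable fun v => normalDensity μ s v * ((v - μ) / s ^ 2) :=
    integrable_normalDensity_mul hs μ (by fun_prop) (A := 1 / s ^ 2) (B := 0) fun v => by
      rw [abs_div, abs_of_pos (by positivity : 0 < s ^ 2)]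
      exact le_of_eq (by ring)
  have iN' : IntegrableOn (fun v => normalDensity μ s v * ((v - μ) / s ^ 2)) T := iM.integrableOn
  have iA' : IntegrableOn (fun v => normalDensity μ s v *
      ((v - μ) / s ^ 2 * stdPhi (y μ v) + g' μ v)) T := by
    refine (((iM.mul_bdd (c := 1) (hΦc μ).aestronglyMeasurable
      (ae_of_all _ (hΦb μ))).add ((integrable_normalDensity hs μ).mul_bdd
      (hg'c μ).aestronglyMeasurable (ae_of_all _ (hg'b μ)))).congr
      (ae_of_all _ fun v => ?_)).integrableOn
    simp only [Pi.add_apply]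
    ring
  have hN0 : 0 < ∫ v in T, normalDensity μ s v :=
    integral_pos_of_ae_pos hT iN (ae_of_all _ (normalDensity_pos hs μ))
  have hA0 : 0 < ∫ v in T, normalDensity μ s v * stdPhi (y μ v) :=
    integral_pos_of_ae_pos hT iA
      (ae_of_all _ fun v => mul_pos (normalDensity_pos hs μ v) (stdPhi_pos _))
  have hAN : ∫ v in T, normalDensity μ s v * stdPhi (y μ v) < ∫ v in T, normalDensity μ s v := by
    rw [← sub_pos, ← integral_sub iN iA]
    refine integral_pos_of_ae_pos hT (iN.sub iA) (ae_of_all _ fun v => ?_)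
    nlinarith [normalDensity_pos hs μ v, stdPhi_lt_one (y μ v)]
  have hF : ∀ m, Fmu a b σ τ m x = (∫ v in T, normalDensity m s v * stdPhi (y m v)) /
      ∫ v in T, normalDensity m s v := fun m => Fmu_eq_div hab hσ hτ hs hs2 m x
  obtain ⟨z, hz⟩ := exists_stdPhi_eq (div_pos hA0 hN0) ((div_lt_one hN0).mpr hAN)
  refine ⟨z, _, hz.trans (hF μ).symm, (hA.div hN hN0.ne').congr_of_eventuallyEq
    (Eventually.of_forall hF), ?_⟩
  have key : 0 < ∫ v in T, ((x - μ) * (normalDensity μ s v * stdPhi (y μ v))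
      - σ ^ 2 * (normalDensity μ s v * ((v - μ) / s ^ 2 * stdPhi (y μ v) + g' μ v))
      - (stdPhi z * (x - μ) + c * stdphi z) * normalDensity μ s v
      + stdPhi z * σ ^ 2 * (normalDensity μ s v * ((v - μ) / s ^ 2))) := by
    refine integral_pos_of_ae_pos hT ((((iA.const_mul _).sub (iA'.const_mul _)).sub
      (iN.const_mul _)).add (iN'.const_mul _)) ?_
    have hne : ∀ᵐ v ∂volume.restrict T, v ≠ (s ^ 2 * (x - c * z) - τ ^ 2 * μ) / σ ^ 2 := by
      simp [ae_iff]
    filter_upwards [hne] with v hv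
    have hyz : y μ v ≠ z := fun h => hv <| by
      rw [← h, hy]
      field_simp
      ring
    have hcy : c * y μ v = (x - μ) - σ ^ 2 * ((v - μ) / s ^ 2) := by
      have : τ ^ 2 = s ^ 2 - σ ^ 2 := by linarith
      rw [hy, this]
      field_simp
      ring
    have hcg : σ ^ 2 * g' μ v = -(c * stdphi (y μ v)) := by
      rw [hg', hc]
      field_simp
    have h := mul_pos (mul_pos (normalDensity_pos hs μ v) hc0)
      (sub_pos.mpr (stdPhi_tangent_lt hyz))
    refine h.trans_eq ?_
    linear_combination normalDensity μ s v * (stdPhi (y μ v) - stdPhi z) * hcy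
      + normalDensity μ s v * hcg
  rw [integral_add, integral_sub, integral_sub, integral_const_mul, integral_const_mul,
    integral_const_mul, integral_const_mul] at key
  rotate_left
  · exact iA.const_mul _
  · exact iA'.const_mul _
  · exact (iA.const_mul _).sub (iA'.const_mul _)
  · exact iN.const_mul _
  · exact ((iA.const_mul _).sub (iA'.const_mul _)).sub (iN.const_mul _)
  · exact iN'.const_mul _
  rw [eq_div_iff hN0.ne'] at hz
  have hcσ : c = τ / s / σ * σ ^ 2 := by
    rw [hc]
    field_simp
  rw [← hz] at key ⊢
  rw [hcσ] at key
  rw [div_lt_iff₀ (by positivity)]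
  refine lt_of_mul_lt_mul_left ?_ (sq_nonneg σ)
  linear_combination (∫ v in T, normalDensity μ s v) * key

/-- Proposition 1: for every `x`, the map `μ ↦ Φ⁻¹(F_μ(x))` is differentiable with derivative
everywhere `< -ρ/σ`, where `ρ² = τ²/(σ²+τ²)`. -/
theorem stmt7 {k : ℕ} (a b : Fin (k + 1) → EReal) (hab : truncOrdered a b)
    (σ τ ρ : ℝ) (hσ : 0 < σ) (hτ : 0 < τ)
    (hρ : 0 < ρ) (hρ2 : ρ ^ 2 = τ ^ 2 / (σ ^ 2 + τ ^ 2)) (x : ℝ) :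
    ∀ μ : ℝ, ∃ d : ℝ,
      HasDerivAt (fun m => stdPhiInv (Fmu a b σ τ m x)) d μ ∧ d < -(ρ / σ) := by
  intro μ
  have hs2 : Real.sqrt (σ ^ 2 + τ ^ 2) ^ 2 = σ ^ 2 + τ ^ 2 := Real.sq_sqrt (by positivity)
  have hs : 0 < Real.sqrt (σ ^ 2 + τ ^ 2) := by positivity
  have hρs : ρ = τ / Real.sqrt (σ ^ 2 + τ ^ 2) := by
    rw [← hs2, ← div_pow] at hρ2
    exact (sq_eq_sq₀ hρ.le (by positivity)).mp hρ2
  obtain ⟨z, e, hz, he, hlt⟩ := hasDerivAt_Fmu_lt hab hσ hτ hs hs2 x μ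
  have hinv := hasDerivAt_stdPhiInv z
  rw [hz] at hinv
  refine ⟨_, hinv.comp μ he, ?_⟩
  rw [inv_mul_lt_iff₀ (stdphi_pos z), hρs]
  linarith
end

section
/- For every x ∈ ℝ, the map μ ↦ F_μ(x) is continuous and strictly decreasing on ℝ, and satisfies lim_{μ→∞} F_μ(x) = 0 and lim_{μ→−∞} F_μ(x) = 1. -/
open MeasureTheory ProbabilityTheory Set Filter Topology

/-! ### Exponential tilts of a measure on the line -/

section ExpTilt

variable {ν : Measure ℝ}

/-- The cumulative distribution function of the exponential tilt of `ν` with parameter `θ`. -/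
noncomputable def expTiltCDF (ν : Measure ℝ) (x θ : ℝ) : ℝ :=
  (∫ u in Iic x, Real.exp (θ * u) ∂ν) / ∫ u, Real.exp (θ * u) ∂ν

lemma setIntegral_exp_pos (hInt : ∀ θ : ℝ, Integrable (fun u => Real.exp (θ * u)) ν)
    {s : Set ℝ} (hs : 0 < ν s) (θ : ℝ) : 0 < ∫ u in s, Real.exp (θ * u) ∂ν := by
  have : NeZero (ν.restrict s) := ⟨by simpa using hs.ne'⟩
  exact integral_exp_pos (hInt θ).restrict

lemma integral_exp_split (hInt : ∀ θ : ℝ, Integrable (fun u => Real.exp (θ * u)) ν) (x θ : ℝ) :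
    ∫ u, Real.exp (θ * u) ∂ν =
      (∫ u in Iic x, Real.exp (θ * u) ∂ν) + ∫ u in Ioi x, Real.exp (θ * u) ∂ν := by
  rw [← integral_add_compl measurableSet_Iic (hInt θ), compl_Iic]

lemma continuous_expTiltCDF (hInt : ∀ θ : ℝ, Integrable (fun u => Real.exp (θ * u)) ν)
    (hν : 0 < ν univ) (x : ℝ) : Continuous (expTiltCDF ν x) := by
  have hA : Continuous (fun θ : ℝ => ∫ u in Iic x, Real.exp (θ * u) ∂ν) :=
    continuous_mgf (X := id) (μ := ν.restrict (Iic x)) fun t => (hInt t).restrict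
  have hD : Continuous (fun θ : ℝ => ∫ u, Real.exp (θ * u) ∂ν) :=
    continuous_mgf (X := id) (μ := ν) hInt
  refine hA.div hD fun θ => ?_
  have := setIntegral_exp_pos hInt hν θ
  rw [Measure.restrict_univ] at this
  exact this.ne'

lemma strictAnti_expTiltCDF (hInt : ∀ θ : ℝ, Integrable (fun u => Real.exp (θ * u)) ν)
    {x : ℝ} (hl : 0 < ν (Iic x)) (hr : 0 < ν (Ioi x)) : StrictAnti (expTiltCDF ν x) := by
  intro θ₁ θ₂ h
  have key : ∀ u, Real.exp (θ₂ * u) = Real.exp ((θ₂ - θ₁) * u) * Real.exp (θ₁ * u) := fun u => by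
    rw [← Real.exp_add]; ring_nf
  set r := Real.exp ((θ₂ - θ₁) * x)
  have hA₁ := setIntegral_exp_pos hInt hl θ₁
  have hA₂ := setIntegral_exp_pos hInt hl θ₂
  have hB₁ := setIntegral_exp_pos hInt hr θ₁
  have hB₂ := setIntegral_exp_pos hInt hr θ₂
  have hA : ∫ u in Iic x, Real.exp (θ₂ * u) ∂ν ≤ r * ∫ u in Iic x, Real.exp (θ₁ * u) ∂ν := by
    rw [← integral_const_mul]
    refine setIntegral_mono_on (hInt _).integrableOn ((hInt _).const_mul _).integrableOn
      measurableSet_Iic fun u hu => ?_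
    rw [key]
    gcongr
    exact Real.exp_le_exp.2 (mul_le_mul_of_nonneg_left hu (sub_nonneg.2 h.le))
  have hB : r * ∫ u in Ioi x, Real.exp (θ₁ * u) ∂ν < ∫ u in Ioi x, Real.exp (θ₂ * u) ∂ν := by
    rw [← integral_const_mul, ← sub_pos,
      ← integral_sub (hInt _).restrict ((hInt _).const_mul _).restrict]
    have hpos : ∀ u ∈ Ioi x, 0 < Real.exp (θ₂ * u) - r * Real.exp (θ₁ * u) := fun u hu => by
      rw [key, ← sub_mul]
      refine mul_pos (sub_pos.2 (Real.exp_lt_exp.2 ?_)) (Real.exp_pos _)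
      exact mul_lt_mul_of_pos_left hu (sub_pos.2 h)
    rw [setIntegral_pos_iff_support_of_nonneg_ae
      (ae_restrict_of_forall_mem measurableSet_Ioi fun u hu => (hpos u hu).le)
      ((hInt _).sub ((hInt _).const_mul _)).integrableOn]
    exact hr.trans_le (measure_mono fun u hu => ⟨(hpos u hu).ne', hu⟩)
  simp only [expTiltCDF, integral_exp_split hInt x]
  rw [div_lt_div_iff₀ (by positivity) (by positivity)]
  nlinarith [mul_le_mul_of_nonneg_right hA hB₁.le, mul_lt_mul_of_pos_left hB hA₁]

lemma tendsto_expTiltCDF_atTop [IsFiniteMeasure ν]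
    (hInt : ∀ θ : ℝ, Integrable (fun u => Real.exp (θ * u)) ν)
    (hr : ∀ y, 0 < ν (Ioi y)) (x : ℝ) : Tendsto (expTiltCDF ν x) atTop (𝓝 0) := by
  have hc : 0 < ν.real (Ioi (x + 1)) := ENNReal.toReal_pos (hr _).ne' (measure_ne_top _ _)
  have hlim : Tendsto (fun θ : ℝ => Real.exp (-θ) * (ν.real (Iic x) / ν.real (Ioi (x + 1))))
      atTop (𝓝 0) := by
    simpa using (Real.tendsto_exp_neg_atTop_nhds_zero).mul_const
      (ν.real (Iic x) / ν.real (Ioi (x + 1)))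
  refine squeeze_zero' (.of_forall fun θ => ?_) ?_ hlim
  · exact div_nonneg (integral_nonneg fun _ => (Real.exp_pos _).le)
      (integral_nonneg fun _ => (Real.exp_pos _).le)
  filter_upwards [eventually_ge_atTop 0] with θ hθ
  have hA : ∫ u in Iic x, Real.exp (θ * u) ∂ν ≤ Real.exp (θ * x) * ν.real (Iic x) := by
    have := setIntegral_mono_on (hInt θ).integrableOn (integrable_const (Real.exp (θ * x)))
      (measurableSet_Iic (a := x))
      fun u hu => Real.exp_le_exp.2 (mul_le_mul_of_nonneg_left hu hθ)
    simpa [mul_comm] using this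
  have hD : Real.exp (θ * (x + 1)) * ν.real (Ioi (x + 1)) ≤ ∫ u, Real.exp (θ * u) ∂ν := by
    have := setIntegral_mono_on (integrable_const (Real.exp (θ * (x + 1)))) (hInt θ).integrableOn
      (measurableSet_Ioi (a := x + 1))
      fun u hu => Real.exp_le_exp.2 (mul_le_mul_of_nonneg_left (mem_Ioi.1 hu).le hθ)
    refine le_trans (by simpa [mul_comm] using this)
      (setIntegral_le_integral (hInt θ) (.of_forall fun _ => (Real.exp_pos _).le))
  calc expTiltCDF ν x θ
      ≤ (Real.exp (θ * x) * ν.real (Iic x)) / (Real.exp (θ * (x + 1)) * ν.real (Ioi (x + 1))) :=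
        div_le_div₀ (by positivity) hA (by positivity) hD
    _ = Real.exp (-θ) * (ν.real (Iic x) / ν.real (Ioi (x + 1))) := by
        rw [mul_div_mul_comm, ← Real.exp_sub]; ring_nf

lemma tendsto_expTiltCDF_atBot [IsFiniteMeasure ν]
    (hInt : ∀ θ : ℝ, Integrable (fun u => Real.exp (θ * u)) ν)
    (hl : ∀ y, 0 < ν (Iic y)) (x : ℝ) : Tendsto (expTiltCDF ν x) atBot (𝓝 1) := by
  have hc : 0 < ν.real (Iic (x - 1)) := ENNReal.toReal_pos (hl _).ne' (measure_ne_top _ _)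
  have hlim : Tendsto (fun θ : ℝ => Real.exp θ * (ν.real (Ioi x) / ν.real (Iic (x - 1))))
      atBot (𝓝 0) := by
    simpa using Real.tendsto_exp_atBot.mul_const (ν.real (Ioi x) / ν.real (Iic (x - 1)))
  have heq : ∀ θ, 1 - expTiltCDF ν x θ =
      (∫ u in Ioi x, Real.exp (θ * u) ∂ν) / ∫ u, Real.exp (θ * u) ∂ν := fun θ => by
    have hA := setIntegral_exp_pos hInt (hl x) θ
    have hB : 0 ≤ ∫ u in Ioi x, Real.exp (θ * u) ∂ν := integral_nonneg fun _ => (Real.exp_pos _).le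
    rw [expTiltCDF, integral_exp_split hInt x]
    field_simp
    ring
  suffices h : Tendsto (fun θ => 1 - expTiltCDF ν x θ) atBot (𝓝 0) by
    simpa using h.const_sub 1
  refine squeeze_zero' (.of_forall fun θ => ?_) ?_ hlim
  · rw [heq]
    exact div_nonneg (integral_nonneg fun _ => (Real.exp_pos _).le)
      (integral_nonneg fun _ => (Real.exp_pos _).le)
  filter_upwards [eventually_le_atBot 0] with θ hθ
  have hB : ∫ u in Ioi x, Real.exp (θ * u) ∂ν ≤ Real.exp (θ * x) * ν.real (Ioi x) := by
    have := setIntegral_mono_on (hInt θ).integrableOn (integrable_const (Real.exp (θ * x)))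
      (measurableSet_Ioi (a := x))
      fun u hu => Real.exp_le_exp.2 (mul_le_mul_of_nonpos_left (mem_Ioi.1 hu).le hθ)
    simpa [mul_comm] using this
  have hD : Real.exp (θ * (x - 1)) * ν.real (Iic (x - 1)) ≤ ∫ u, Real.exp (θ * u) ∂ν := by
    have := setIntegral_mono_on (integrable_const (Real.exp (θ * (x - 1)))) (hInt θ).integrableOn
      (measurableSet_Iic (a := x - 1))
      fun u hu => Real.exp_le_exp.2 (mul_le_mul_of_nonpos_left (mem_Iic.1 hu) hθ)
    refine le_trans (by simpa [mul_comm] using this)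
      (setIntegral_le_integral (hInt θ) (.of_forall fun _ => (Real.exp_pos _).le))
  calc 1 - expTiltCDF ν x θ
      ≤ (Real.exp (θ * x) * ν.real (Ioi x)) / (Real.exp (θ * (x - 1)) * ν.real (Iic (x - 1))) := by
        rw [heq]
        exact div_le_div₀ (by positivity) hB (by positivity) hD
    _ = Real.exp θ * (ν.real (Ioi x) / ν.real (Iic (x - 1))) := by
        rw [mul_div_mul_comm, ← Real.exp_sub]; ring_nf

end ExpTilt

/-! ### Gaussian probabilities -/

lemma stdphi_div (μ : ℝ) {s : ℝ} (hs : 0 < s) (u : ℝ) :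
    1 / s * stdphi ((u - μ) / s) = gaussianPDFReal μ (s ^ 2).toNNReal u := by
  rw [stdphi, gaussianPDFReal, Real.coe_toNNReal _ (sq_nonneg s),
    Real.sqrt_mul (by positivity) (s ^ 2), Real.sqrt_sq hs.le]
  have : -((u - μ) / s) ^ 2 / 2 = -(u - μ) ^ 2 / (2 * s ^ 2) := by field_simp
  rw [this]
  field_simp

lemma stdPhi_eq_gaussianReal (x : ℝ) : stdPhi x = (gaussianReal 0 1).real (Iic x) := by
  have h : ∀ t, stdphi t = gaussianPDFReal 0 1 t := fun t => by
    simpa using stdphi_div 0 one_pos t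
  rw [measureReal_def, gaussianReal_apply_eq_integral 0 one_ne_zero, stdPhi,
    ENNReal.toReal_ofReal (integral_nonneg fun t => gaussianPDFReal_nonneg 0 1 t)]
  simp only [h]

lemma stdPhi_div_eq_gaussianReal (c x : ℝ) {s : ℝ} (hs : 0 < s) :
    stdPhi ((c - x) / s) = (gaussianReal x (s ^ 2).toNNReal).real (Iic c) := by
  have h1 : (gaussianReal 0 1).map (fun y => s * y) = gaussianReal 0 (s ^ 2).toNNReal := by
    rw [gaussianReal_map_const_mul]
    congr 1
    · simp
    · ext; simp [sq_nonneg]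
  have h2 : (gaussianReal 0 (s ^ 2).toNNReal).map (fun y => y + x) =
      gaussianReal x (s ^ 2).toNNReal := by
    rw [gaussianReal_map_add_const, zero_add]
  rw [stdPhi_eq_gaussianReal, ← h2, ← h1, Measure.map_map (by fun_prop) (by fun_prop),
    map_measureReal_apply (by fun_prop) measurableSet_Iic]
  congr 1
  ext y
  simp only [mem_Iic, mem_preimage, Function.comp_apply, le_div_iff₀ hs, le_sub_iff_add_le,
    mul_comm]

lemma stdPhiE_eq_gaussianReal (c : EReal) (x : ℝ) {s : ℝ} (hs : 0 < s) :
    stdPhiE c x s = (gaussianReal x (s ^ 2).toNNReal).real {y : ℝ | (y : EReal) ≤ c} := by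
  induction c with
  | bot => simp [stdPhiE]
  | top => simp [stdPhiE]
  | coe c => simpa [stdPhiE, Iic] using stdPhi_div_eq_gaussianReal c x hs

lemma measurableSet_coe_le (c : EReal) : MeasurableSet {y : ℝ | (y : EReal) ≤ c} :=
  measurable_coe_real_ereal measurableSet_Iic

lemma stdPhiE_lt_stdPhiE {c d : EReal} (hcd : c < d) (x : ℝ) {s : ℝ} (hs : 0 < s) :
    stdPhiE c x s < stdPhiE d x s := by
  have hv : (s ^ 2).toNNReal ≠ 0 := by simpa using hs.ne'
  have hsub : {y : ℝ | (y : EReal) ≤ c} ⊆ {y : ℝ | (y : EReal) ≤ d} := fun _ hy =>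
    le_trans hy hcd.le
  rw [stdPhiE_eq_gaussianReal c x hs, stdPhiE_eq_gaussianReal d x hs, ← sub_pos,
    ← measureReal_sdiff hsub (measurableSet_coe_le c)]
  refine ENNReal.toReal_pos (fun h0 => ?_) (measure_ne_top _ _)
  have hvol := gaussianReal_absolutelyContinuous' x hv h0
  have hopen : IsOpen ((fun y : ℝ => (y : EReal)) ⁻¹' Ioo c d) :=
    isOpen_Ioo.preimage continuous_coe_real_ereal
  obtain ⟨y, hy⟩ := EReal.lt_iff_exists_real_btwn.1 hcd
  refine (hopen.measure_pos volume ⟨y, hy⟩).ne' (measure_mono_null (fun z hz => ?_) hvol)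
  exact ⟨hz.2.le, not_le.2 hz.1⟩

lemma truncSum_pos {k : ℕ} {a b : Fin (k + 1) → EReal} (hab : ∀ i, a i < b i) {s : ℝ}
    (hs : 0 < s) (x : ℝ) : 0 < truncSum a b s x :=
  Finset.sum_pos (fun i _ => sub_pos.2 (stdPhiE_lt_stdPhiE (hab i) x hs)) Finset.univ_nonempty

lemma measurable_stdPhiE (c : EReal) (s : ℝ) :
    Measurable (fun x => stdPhiE c x s) := by
  have hmono : Monotone stdPhi := fun x y hxy => by
    simp only [stdPhi_eq_gaussianReal]
    exact measureReal_mono (Iic_subset_Iic.2 hxy)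
  unfold stdPhiE
  split_ifs
  · fun_prop
  · fun_prop
  · exact hmono.measurable.comp (by fun_prop)

lemma integrable_stdPhiE (γ : Measure ℝ) [IsFiniteMeasure γ] (c : EReal) {s : ℝ} (hs : 0 < s) :
    Integrable (fun x => stdPhiE c x s) γ := by
  refine Integrable.of_bound (measurable_stdPhiE c s).aestronglyMeasurable 1 (.of_forall fun x => ?_)
  rw [stdPhiE_eq_gaussianReal c x hs, Real.norm_of_nonneg measureReal_nonneg]
  exact measureReal_le_one

lemma measurable_truncSum {k : ℕ} (a b : Fin k → EReal) (s : ℝ) :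
    Measurable (truncSum a b s) :=
  Finset.measurable_fun_sum _ fun i _ =>
    (measurable_stdPhiE (b i) s).sub (measurable_stdPhiE (a i) s)

lemma abs_truncSum_le {k : ℕ} (a b : Fin k → EReal) {s : ℝ} (hs : 0 < s) (x : ℝ) :
    |truncSum a b s x| ≤ k := by
  have h : ∀ c, 0 ≤ stdPhiE c x s ∧ stdPhiE c x s ≤ 1 := fun c => by
    rw [stdPhiE_eq_gaussianReal c x hs]
    exact ⟨measureReal_nonneg, measureReal_le_one⟩
  refine (Finset.abs_sum_le_sum_abs _ _).trans ?_
  have : ∀ i ∈ Finset.univ, |stdPhiE (b i) x s - stdPhiE (a i) x s| ≤ 1 := fun i _ =>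
    abs_le.2 ⟨by linarith [(h (b i)).1, (h (a i)).2], by linarith [(h (b i)).2, (h (a i)).1]⟩
  simpa using Finset.sum_le_sum this

lemma integral_gaussianReal_measureReal (μ : ℝ) (v w : NNReal) {s : Set ℝ}
    (hs : MeasurableSet s) :
    ∫ u, (gaussianReal u w).real s ∂(gaussianReal μ v) = (gaussianReal μ (v + w)).real s := by
  have hconv : gaussianReal μ v ∗ gaussianReal 0 w = gaussianReal μ (v + w) := by
    rw [gaussianReal_conv_gaussianReal, add_zero]
  rw [← hconv, ← integral_indicator_one hs, integral_conv]
  · refine integral_congr_ae (.of_forall fun u => ?_)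
    have hmap : (gaussianReal 0 w).map (fun y => u + y) = gaussianReal u w := by
      rw [gaussianReal_map_const_add, zero_add]
    simp only [← hmap]
    rw [← integral_indicator_one hs]
    exact integral_map (by fun_prop) (measurable_one.indicator hs).aestronglyMeasurable
  · exact (integrable_const (1 : ℝ)).indicator hs

lemma integral_stdPhiE_gaussianReal (c : EReal) (μ : ℝ) {σ τ : ℝ} (hσ : 0 < σ) (hτ : 0 < τ) :
    ∫ u, stdPhiE c u τ ∂(gaussianReal μ (σ ^ 2).toNNReal) =
      stdPhiE c μ (Real.sqrt (σ ^ 2 + τ ^ 2)) := by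
  simp only [stdPhiE_eq_gaussianReal c _ hτ]
  rw [stdPhiE_eq_gaussianReal c _ (by positivity),
    integral_gaussianReal_measureReal _ _ _ (measurableSet_coe_le c),
    Real.sq_sqrt (by positivity), Real.toNNReal_add (by positivity) (by positivity)]

lemma integral_truncSum_gaussianReal {k : ℕ} (a b : Fin k → EReal) (μ : ℝ) {σ τ : ℝ}
    (hσ : 0 < σ) (hτ : 0 < τ) :
    ∫ u, truncSum a b τ u ∂(gaussianReal μ (σ ^ 2).toNNReal) =
      truncSum a b (Real.sqrt (σ ^ 2 + τ ^ 2)) μ := by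
  have hInt : ∀ c, Integrable (fun u => stdPhiE c u τ) (gaussianReal μ (σ ^ 2).toNNReal) :=
    fun c => integrable_stdPhiE _ c hτ
  unfold truncSum
  rw [integral_finsetSum _ fun i _ => by exact (hInt (b i)).sub (hInt (a i))]
  refine Finset.sum_congr rfl fun i _ => ?_
  rw [integral_sub (hInt _) (hInt _),
    integral_stdPhiE_gaussianReal _ _ hσ hτ, integral_stdPhiE_gaussianReal _ _ hσ hτ]

/-! ### The conditional distribution as an exponential tilt -/

/-- The centred normal law of variance `σ²`, weighted by the conditional probability of
truncation. -/
noncomputable def truncMeasure {k : ℕ} (a b : Fin k → EReal) (σ τ : ℝ) : Measure ℝ :=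
  (gaussianReal 0 (σ ^ 2).toNNReal).withDensity fun u => ENNReal.ofReal (truncSum a b τ u)

lemma gaussianPDFReal_eq_exp_mul (μ : ℝ) {σ : ℝ} (hσ : 0 < σ) (u : ℝ) :
    gaussianPDFReal μ (σ ^ 2).toNNReal u = Real.exp (-(μ ^ 2 / (2 * σ ^ 2))) *
      (Real.exp (μ / σ ^ 2 * u) * gaussianPDFReal 0 (σ ^ 2).toNNReal u) := by
  simp only [gaussianPDFReal, Real.coe_toNNReal _ (sq_nonneg σ)]
  have : -(u - μ) ^ 2 / (2 * σ ^ 2) =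
      -(μ ^ 2 / (2 * σ ^ 2)) + (μ / σ ^ 2 * u + -(u - 0) ^ 2 / (2 * σ ^ 2)) := by
    field_simp
    ring
  rw [this, Real.exp_add, Real.exp_add]
  ring

section TruncMeasure

variable {k : ℕ} {a b : Fin (k + 1) → EReal} {σ τ : ℝ}

lemma measurable_ofReal_truncSum (a b : Fin (k + 1) → EReal) (τ : ℝ) :
    Measurable fun u => ENNReal.ofReal (truncSum a b τ u) :=
  (measurable_truncSum a b τ).ennreal_ofReal

lemma isFiniteMeasure_truncMeasure (a b : Fin (k + 1) → EReal) (σ : ℝ) (hτ : 0 < τ) :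
    IsFiniteMeasure (truncMeasure a b σ τ) := by
  refine isFiniteMeasure_withDensity_ofReal (Integrable.hasFiniteIntegral ?_)
  exact Integrable.of_bound (measurable_truncSum a b τ).aestronglyMeasurable ((k + 1 : ℕ) : ℝ)
    (.of_forall (abs_truncSum_le a b hτ))

lemma integrable_exp_truncMeasure (a b : Fin (k + 1) → EReal) (σ : ℝ) (hτ : 0 < τ) (θ : ℝ) :
    Integrable (fun u => Real.exp (θ * u)) (truncMeasure a b σ τ) := by
  rw [truncMeasure, integrable_withDensity_iff_integrable_smul'
    (measurable_ofReal_truncSum a b τ) (.of_forall fun _ => ENNReal.ofReal_lt_top)]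
  refine (integrable_exp_mul_gaussianReal θ).bdd_mul (c := ((k + 1 : ℕ) : ℝ))
    (measurable_ofReal_truncSum a b τ).ennreal_toReal.aestronglyMeasurable
    (.of_forall fun u => ?_)
  rw [Real.norm_of_nonneg ENNReal.toReal_nonneg, ENNReal.toReal_ofReal']
  exact max_le ((le_abs_self _).trans (abs_truncSum_le a b hτ u)) (by positivity)

lemma truncMeasure_pos (hab : ∀ i, a i < b i) (hσ : 0 < σ) (hτ : 0 < τ) {s : Set ℝ}
    (hs : 0 < volume s) : 0 < truncMeasure a b σ τ s := by
  have hv : (σ ^ 2).toNNReal ≠ 0 := by simpa using hσ.ne'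
  refine pos_iff_ne_zero.2 fun h0 => hs.ne' (gaussianReal_absolutelyContinuous' 0 hv ?_)
  refine withDensity_absolutelyContinuous' (measurable_ofReal_truncSum a b τ).aemeasurable
    (.of_forall fun u => ?_) h0
  simpa using truncSum_pos hab hτ u

lemma setIntegral_gaussianPDFReal_mul_truncSum (hab : ∀ i, a i < b i) (hσ : 0 < σ) (hτ : 0 < τ)
    (μ : ℝ) {s : Set ℝ} (hs : MeasurableSet s) :
    ∫ u in s, gaussianPDFReal μ (σ ^ 2).toNNReal u * truncSum a b τ u =
      Real.exp (-(μ ^ 2 / (2 * σ ^ 2))) *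
        ∫ u in s, Real.exp (μ / σ ^ 2 * u) ∂(truncMeasure a b σ τ) := by
  have hv : (σ ^ 2).toNNReal ≠ 0 := by simpa using hσ.ne'
  rw [truncMeasure, setIntegral_withDensity_eq_setIntegral_toReal_smul
      (measurable_ofReal_truncSum a b τ) (.of_forall fun _ => ENNReal.ofReal_lt_top) _ hs,
    gaussianReal_of_var_ne_zero _ hv, setIntegral_withDensity_eq_setIntegral_toReal_smul
      (measurable_gaussianPDF _ _) (.of_forall fun _ => gaussianPDF_lt_top) _ hs,
    ← integral_const_mul]
  refine integral_congr_ae (.of_forall fun u => ?_)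
  simp only [toReal_gaussianPDF, ENNReal.toReal_ofReal (truncSum_pos hab hτ u).le, smul_eq_mul]
  rw [gaussianPDFReal_eq_exp_mul μ hσ u]
  ring

lemma Fmu_eq_expTiltCDF (hab : ∀ i, a i < b i) (hσ : 0 < σ) (hτ : 0 < τ) (μ x : ℝ) :
    Fmu a b σ τ μ x = expTiltCDF (truncMeasure a b σ τ) x (μ / σ ^ 2) := by
  have hv : (σ ^ 2).toNNReal ≠ 0 := by simpa using hσ.ne'
  have hden : truncSum a b (Real.sqrt (σ ^ 2 + τ ^ 2)) μ = Real.exp (-(μ ^ 2 / (2 * σ ^ 2))) *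
      ∫ u, Real.exp (μ / σ ^ 2 * u) ∂(truncMeasure a b σ τ) := by
    have := setIntegral_gaussianPDFReal_mul_truncSum hab hσ hτ μ MeasurableSet.univ
    rw [Measure.restrict_univ, Measure.restrict_univ] at this
    rw [← this, ← integral_truncSum_gaussianReal a b μ hσ hτ,
      integral_gaussianReal_eq_integral_smul hv]
    rfl
  simp only [Fmu, condPDF, stdphi_div μ hσ]
  rw [integral_div, setIntegral_gaussianPDFReal_mul_truncSum hab hσ hτ μ measurableSet_Iic, hden,
    mul_div_mul_left _ _ (Real.exp_pos _).ne', expTiltCDF]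

end TruncMeasure

/-- Lemma (`le_cdf`): for every `x`, `μ ↦ F_μ(x)` is continuous, strictly decreasing, tends to
`0` as `μ → ∞` and to `1` as `μ → -∞`. -/
theorem stmt13 {k : ℕ} (a b : Fin (k + 1) → EReal) (hab : truncOrdered a b)
    (σ τ : ℝ) (hσ : 0 < σ) (hτ : 0 < τ) (x : ℝ) :
    Continuous (fun μ => Fmu a b σ τ μ x) ∧
    StrictAnti (fun μ => Fmu a b σ τ μ x) ∧
    Tendsto (fun μ => Fmu a b σ τ μ x) atTop (𝓝 0) ∧
    Tendsto (fun μ => Fmu a b σ τ μ x) atBot (𝓝 1) := by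
  have := isFiniteMeasure_truncMeasure a b σ hτ
  have hInt := integrable_exp_truncMeasure a b σ hτ
  have hl : ∀ y, 0 < truncMeasure a b σ τ (Iic y) := fun y =>
    truncMeasure_pos hab.1 hσ hτ (by simp)
  have hr : ∀ y, 0 < truncMeasure a b σ τ (Ioi y) := fun y =>
    truncMeasure_pos hab.1 hσ hτ (by simp)
  have hσ2 : 0 < σ ^ 2 := by positivity
  simp only [Fmu_eq_expTiltCDF hab.1 hσ hτ]
  refine ⟨?_, ?_, ?_, ?_⟩
  · exact (continuous_expTiltCDF hInt ((hl x).trans_le (measure_mono (subset_univ _))) x).comp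
      (continuous_id.div_const _)
  · exact (strictAnti_expTiltCDF hInt (hl x) (hr x)).comp_strictMono
      fun _ _ h => div_lt_div_of_pos_right h hσ2
  · exact (tendsto_expTiltCDF_atTop hInt hr x).comp (tendsto_id.atTop_div_const hσ2)
  · exact (tendsto_expTiltCDF_atBot hInt hl x).comp (tendsto_id.atBot_div_const hσ2)
end
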